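/- Let 1 < α < 2, 0 ≤ p ≤ 1, and let μ, ν ∈ [α−2, 0] satisfy μ + ν = α − 2 and p·sin(πμ) = (1−p)·sin(πν). Then for every integer n ≥ 0 and every x ∈ (−1,1), (I_p^{2−α} J_n^{−μ,−ν})(x) = (Γ(n+α−1)/Γ(n+1))·P_n^{ν,μ}(x). -/

import Mathlib

open MeasureTheory Real Set Finset

noncomputable section

/-- The interval Λ = (−1, 1). -/
def Lam : Set ℝ := Set.Ioo (-1 : ℝ) 1

/-- Left Riemann–Liouville fractional integral of order `σ` on `(−1,1)`;
`Il 0` is the identity. -/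
def Il (σ : ℝ) (v : ℝ → ℝ) (x : ℝ) : ℝ :=
  if σ = 0 then v x
  else (1 / Real.Gamma σ) * ∫ y in (-1 : ℝ)..x, (x - y) ^ (σ - 1) * v y

/-- Right Riemann–Liouville fractional integral of order `σ` on `(−1,1)`;
`Ir 0` is the identity. -/
def Ir (σ : ℝ) (v : ℝ → ℝ) (x : ℝ) : ℝ :=
  if σ = 0 then v x
  else (1 / Real.Gamma σ) * ∫ y in x..(1 : ℝ), (y - x) ^ (σ - 1) * v y

/-- The constant `C_{α,p} = (sin(πμ) + sin(πν)) / sin(πα)`. -/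
def Cap (α μ ν : ℝ) : ℝ := (Real.sin (π * μ) + Real.sin (π * ν)) / Real.sin (π * α)

/-- Two-sided fractional integral `I_p^σ v = C_{α,p}(p I_l^σ v + (1−p) I_r^σ v)`. -/
def Ip (α μ ν p σ : ℝ) (v : ℝ → ℝ) (x : ℝ) : ℝ :=
  Cap α μ ν * (p * Il σ v x + (1 - p) * Ir σ v x)

/-- Two-sided Riemann–Liouville fractional derivative of order `α − 1`. -/
def Dp (α μ ν p : ℝ) (v : ℝ → ℝ) : ℝ → ℝ := deriv (Ip α μ ν p (2 - α) v)

/-- Jacobi polynomial `P_n^{a,b}` given by its explicit hypergeometric sum. -/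
def jacobiP (n : ℕ) (a b : ℝ) (x : ℝ) : ℝ :=
  ∑ m ∈ Finset.range (n + 1),
    (Real.Gamma (a + n + 1) * Real.Gamma (a + b + n + m + 1)) /
      ((m.factorial : ℝ) * ((n - m).factorial : ℝ) * Real.Gamma (a + b + n + 1) *
        Real.Gamma (a + m + 1)) * ((x - 1) / 2) ^ m

/-- Jacobi poly-fractonomial `J_n^{−a,−b}(x) = (1−x)^a (1+x)^b P_n^{a,b}(x)`. -/
def Jpf (n : ℕ) (a b : ℝ) (x : ℝ) : ℝ :=
  (1 - x) ^ a * (1 + x) ^ b * jacobiP n a b x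

/-- Membership in the fractional derivative space `H_RL^{α−1}(Λ)`. -/
def MemH (α μ ν p : ℝ) (v : ℝ → ℝ) : Prop :=
  IntegrableOn (fun x => (Ip α μ ν p (2 - α) v x) ^ 2) Lam ∧
    IntegrableOn (fun x => (Dp α μ ν p v x) ^ 2) Lam

/-- Squared norm of `H_RL^{α−1}(Λ)`. -/
def HnormSq (α μ ν p : ℝ) (v : ℝ → ℝ) : ℝ :=
  (∫ x in Lam, (Ip α μ ν p (2 - α) v x) ^ 2) + ∫ x in Lam, (Dp α μ ν p v x) ^ 2

/-- The bilinear form `A(u,v) = c(u, I_p^{2−α}v) + (D_p^{α−1}u, D_p^{α−1}v)`. -/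
def Aform (α μ ν p c : ℝ) (u v : ℝ → ℝ) : ℝ :=
  c * (∫ x in Lam, u x * Ip α μ ν p (2 - α) v x) +
    ∫ x in Lam, Dp α μ ν p u x * Dp α μ ν p v x

/-- Incomplete Fourier transform `F^c(w)(ξ) = (1/2π) ∫_{−1}^1 w(x) e^{iξx} dx`. -/
def Fc (w : ℝ → ℝ) (ξ : ℝ) : ℂ :=
  ((1 / (2 * π) : ℝ) : ℂ) *
    ∫ x in (-1 : ℝ)..1, (w x : ℂ) * Complex.exp (Complex.I * ξ * x)

/-- The Euler-type integral `∫₀¹ (1 - t)^(s-1) t^b (X - t)^a dt`. -/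
def eulerInt (s b a X : ℝ) : ℝ :=
  ∫ t in (0 : ℝ)..1, (1 - t) ^ (s - 1) * t ^ b * (X - t) ^ a

lemma intervalIntegrable_betaWeight {s b : ℝ} (hs : 0 < s) (hb : -1 < b) :
    IntervalIntegrable (fun t : ℝ => (1 - t) ^ (s - 1) * t ^ b) volume 0 1 := by
  have h1 : IntervalIntegrable (fun t : ℝ => (1 - t) ^ (s - 1) * t ^ b) volume 0 (1 / 2) := by
    refine (intervalIntegral.intervalIntegrable_rpow' hb).continuousOn_mul ?_
    refine ContinuousOn.rpow_const (by fun_prop) fun t ht => Or.inl ?_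
    rw [Set.uIcc_of_le (by norm_num)] at ht
    linarith [ht.2]
  have h2 : IntervalIntegrable (fun t : ℝ => (1 - t) ^ (s - 1) * t ^ b) volume (1 / 2) 1 := by
    have h3 : IntervalIntegrable (fun t : ℝ => (1 - t) ^ (s - 1)) volume (1 / 2) 1 := by
      have := (intervalIntegral.intervalIntegrable_rpow' (a := 1 / 2) (b := 0)
        (show -1 < s - 1 by linarith)).comp_sub_left 1
      norm_num at this ⊢
      exact this
    refine h3.mul_continuousOn ?_
    refine ContinuousOn.rpow_const (by fun_prop) fun t ht => Or.inl ?_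
    rw [Set.uIcc_of_le (by norm_num)] at ht
    linarith [ht.1]
  exact h1.trans h2

lemma integral_betaWeight {s b : ℝ} (hs : 0 < s) (hb : -1 < b) :
    ∫ t in (0 : ℝ)..1, (1 - t) ^ (s - 1) * t ^ b =
      Real.Gamma (b + 1) * Real.Gamma s / Real.Gamma (b + 1 + s) := by
  have h := ProbabilityTheory.beta_eq_betaIntegralReal (b + 1) s (by linarith) hs
  rw [ProbabilityTheory.beta] at h
  rw [h, ← Complex.ofReal_re (∫ t in (0 : ℝ)..1, (1 - t) ^ (s - 1) * t ^ b)]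
  congr 1
  rw [Complex.betaIntegral, ← intervalIntegral.integral_ofReal]
  refine intervalIntegral.integral_congr fun t ht => ?_
  rw [Set.uIcc_of_le zero_le_one] at ht
  rw [Complex.ofReal_mul, Complex.ofReal_cpow (by linarith [ht.2]), Complex.ofReal_cpow ht.1]
  push_cast
  ring_nf

lemma intervalIntegrable_eulerInt {s b X : ℝ} (hs : 0 < s) (hb : -1 < b) (a : ℝ) (hX : 1 < X) :
    IntervalIntegrable (fun t : ℝ => (1 - t) ^ (s - 1) * t ^ b * (X - t) ^ a) volume 0 1 := by
  refine (intervalIntegrable_betaWeight hs hb).mul_continuousOn ?_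
  refine ContinuousOn.rpow_const (by fun_prop) fun t ht => Or.inl ?_
  rw [Set.uIcc_of_le zero_le_one] at ht
  linarith [ht.2]

lemma eulerInt_add_one {s b a X : ℝ} (hs : 0 < s) (hb : -1 < b) (hX : 1 < X) :
    eulerInt s b (a + 1) X = X * eulerInt s b a X - eulerInt s (b + 1) a X := by
  unfold eulerInt
  rw [← intervalIntegral.integral_const_mul, ← intervalIntegral.integral_sub
    ((intervalIntegrable_eulerInt hs hb a hX).const_mul X)
    (intervalIntegrable_eulerInt hs (by linarith) a hX)]
  refine intervalIntegral.integral_congr_ae (Filter.Eventually.of_forall fun t ht => ?_)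
  rw [Set.uIoc_of_le zero_le_one] at ht
  rw [rpow_add_one (by linarith [ht.2]), rpow_add_one (by linarith [ht.1])]
  ring

lemma eulerInt_three_term {s b a X : ℝ} (hs : 0 < s) (hb : -1 < b) (hX : 1 < X) :
    (s + b + a + 2) * eulerInt s b (a + 2) X
      + (-s * X + (b + 1) * (1 - X) - (a + 1) * (2 * X - 1)) * eulerInt s b (a + 1) X
      + (a + 1) * X * (X - 1) * eulerInt s b a X = 0 := by
  have i2 := (intervalIntegrable_eulerInt hs hb (a + 2) hX).const_mul (s + b + a + 2)
  have i1 := (intervalIntegrable_eulerInt hs hb (a + 1) hX).const_mul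
    (-s * X + (b + 1) * (1 - X) - (a + 1) * (2 * X - 1))
  have i0 := (intervalIntegrable_eulerInt hs hb a hX).const_mul ((a + 1) * X * (X - 1))
  unfold eulerInt
  rw [← intervalIntegral.integral_const_mul, ← intervalIntegral.integral_const_mul,
    ← intervalIntegral.integral_const_mul, ← intervalIntegral.integral_add i2 i1,
    ← intervalIntegral.integral_add (i2.add i1) i0]
  rw [intervalIntegral.integral_eq_sub_of_hasDerivAt_of_le
    (f := fun t => (1 - t) ^ s * t ^ (b + 1) * (X - t) ^ (a + 1)) zero_le_one ?_ ?_
    ((i2.add i1).add i0)]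
  · simp [hs.ne', (by linarith : b + 1 ≠ 0)]
  · refine ContinuousOn.mul (ContinuousOn.mul ?_ ?_) ?_
    · exact ContinuousOn.rpow_const (by fun_prop) fun t ht => Or.inr hs.le
    · exact ContinuousOn.rpow_const (by fun_prop) fun t ht => Or.inr (by linarith)
    · exact ContinuousOn.rpow_const (by fun_prop) fun t ht => Or.inl (by linarith [ht.2])
  · intro t ht
    have h1 : 1 - t ≠ 0 := by linarith [ht.2]
    have h2 : X - t ≠ 0 := by linarith [ht.2]
    have d1 := ((hasDerivAt_id t).const_sub 1).rpow_const (p := s) (Or.inl h1)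
    have d2 := (hasDerivAt_id t).rpow_const (p := b + 1) (Or.inl ht.1.ne')
    have d3 := ((hasDerivAt_id t).const_sub X).rpow_const (p := a + 1) (Or.inl h2)
    refine ((d1.mul d2).mul d3).congr_deriv ?_
    simp only [id, add_sub_cancel_right, Pi.mul_apply]
    have e1 : (1 - t) ^ s = (1 - t) ^ (s - 1) * (1 - t) := by
      rw [← rpow_add_one h1]; ring_nf
    have e3 : (X - t) ^ (a + 2) = (X - t) ^ a * (X - t) * (X - t) := by
      rw [← rpow_add_one h2, ← rpow_add_one h2]; ring_nf
    rw [e1, e3, rpow_add_one h2, rpow_add_one ht.1.ne']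
    ring

lemma hasDerivAt_eulerInt {s b X : ℝ} (hs : 0 < s) (hb : -1 < b) (a : ℝ) (hX : 1 < X) :
    HasDerivAt (eulerInt s b a) (a * eulerInt s b (a - 1) X) X := by
  obtain ⟨C, hC⟩ : ∃ C, ∀ u ∈ Icc ((X - 1) / 2) (X + 1), ‖a * u ^ (a - 1)‖ ≤ C := by
    refine isCompact_Icc.exists_bound_of_continuousOn ?_
    refine continuousOn_const.mul (ContinuousOn.rpow_const (by fun_prop) fun u hu => Or.inl ?_)
    linarith [hu.1]
  have hs' : Ioo ((X + 1) / 2) (X + 1) ∈ nhds X := Ioo_mem_nhds (by linarith) (by linarith)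
  have key := intervalIntegral.hasDerivAt_integral_of_dominated_loc_of_deriv_le
    (F := fun x t : ℝ => (1 - t) ^ (s - 1) * t ^ b * (x - t) ^ a)
    (F' := fun x t : ℝ => (1 - t) ^ (s - 1) * t ^ b * (a * (x - t) ^ (a - 1)))
    (μ := volume) (a := 0) (b := 1)
    (bound := fun t => (1 - t) ^ (s - 1) * t ^ b * C) hs' ?_
    (intervalIntegrable_eulerInt hs hb a hX) ?_ ?_
    ((intervalIntegrable_betaWeight hs hb).mul_const C) ?_
  · refine key.2.congr_deriv ?_
    unfold eulerInt
    rw [← intervalIntegral.integral_const_mul]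
    congr 1
    ext t
    ring
  · filter_upwards [Ioi_mem_nhds hX] with x hx
    exact (intervalIntegrable_eulerInt hs hb a hx).aestronglyMeasurable_restrict_uIoc
  · have := ((intervalIntegrable_eulerInt hs hb (a - 1) hX).const_mul
      a).aestronglyMeasurable_restrict_uIoc
    refine this.congr (Filter.Eventually.of_forall fun t => ?_)
    simp only
    ring
  · refine Filter.Eventually.of_forall fun t ht x hx => ?_
    rw [Set.uIoc_of_le zero_le_one] at ht
    have h0 : 0 ≤ (1 - t) ^ (s - 1) * t ^ b :=
      mul_nonneg (rpow_nonneg (by linarith [ht.2]) _) (rpow_nonneg ht.1.le _)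
    rw [norm_mul, norm_of_nonneg h0]
    exact mul_le_mul_of_nonneg_left
      (hC _ ⟨by linarith [hx.1, ht.2], by linarith [hx.2, ht.1]⟩) h0
  · refine Filter.Eventually.of_forall fun t ht x hx => ?_
    rw [Set.uIoc_of_le zero_le_one] at ht
    have h1 : x - t ≠ 0 := by linarith [hx.1, ht.2]
    refine ((((hasDerivAt_id x).sub_const t).rpow_const (p := a) (Or.inl h1)).const_mul
      ((1 - t) ^ (s - 1) * t ^ b)).congr_deriv ?_
    simp

lemma eulerInt_closed_form {s b X : ℝ} (hs : 0 < s) (hb : -1 < b) (hX : 1 < X) :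
    eulerInt s b (-s - b - 1) X = (X - 1) ^ (-b - 1) * X ^ (-s) *
      (Real.Gamma (b + 1) * Real.Gamma s / Real.Gamma (b + 1 + s)) := by
  have hX0 : 0 < X := by linarith
  have hX1 : 0 < X - 1 := by linarith
  have hne : ∀ t ∈ Icc (0 : ℝ) 1, 0 < X - t := fun t ht => by linarith [ht.2]
  have hcompl : ∀ t ∈ Icc (0 : ℝ) 1, 1 - (X - 1) * t / (X - t) = X * (1 - t) / (X - t) := by
    intro t ht
    have := (hne t ht).ne'
    field_simp
    ring
  have hpt : ∀ t ∈ Icc (0 : ℝ) 1,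
      ((fun v : ℝ => (1 - v) ^ (s - 1) * v ^ b) ∘ fun t => (X - 1) * t / (X - t)) t *
        ((X - 1) * X / (X - t) ^ 2) =
      ((X - 1) ^ (b + 1) * X ^ s) * ((1 - t) ^ (s - 1) * t ^ b * (X - t) ^ (-s - b - 1)) := by
    intro t ht
    have h := hne t ht
    have h1 : 0 ≤ 1 - t := by linarith [ht.2]
    simp only [Function.comp]
    rw [hcompl t ht, div_rpow (by positivity) h.le, div_rpow (mul_nonneg hX1.le ht.1) h.le,
      mul_rpow hX0.le h1, mul_rpow hX1.le ht.1, rpow_add_one hX1.ne',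
      show -s - b - 1 = -((s - 1) + b + (2 : ℕ)) by push_cast; ring, rpow_neg h.le,
      rpow_add h, rpow_add h, rpow_natCast,
      show X ^ s = X ^ (s - 1) * X by rw [← rpow_add_one hX0.ne']; ring_nf]
    have := (rpow_pos_of_pos h (s - 1)).ne'
    have := (rpow_pos_of_pos h b).ne'
    field_simp
  have himg : (fun t => (X - 1) * t / (X - t)) '' Set.uIcc (0 : ℝ) 1 ⊆ Icc 0 1 := by
    rintro _ ⟨t, ht, rfl⟩
    rw [Set.uIcc_of_le zero_le_one] at ht
    have h := hne t ht
    have h1 : 0 ≤ 1 - t := by linarith [ht.2]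
    have h2 := ht.1
    have h3 : 0 ≤ X * (1 - t) / (X - t) := by positivity
    exact ⟨by positivity, by linarith [hcompl t ht]⟩
  have hsub := intervalIntegral.integral_comp_mul_deriv''' (a := 0) (b := 1)
    (f := fun t => (X - 1) * t / (X - t)) (f' := fun t => (X - 1) * X / (X - t) ^ 2)
    (g := fun v : ℝ => (1 - v) ^ (s - 1) * v ^ b) ?_ ?_ ?_ ?_ ?_
  · rw [intervalIntegral.integral_congr (g := fun t => ((X - 1) ^ (b + 1) * X ^ s) *
      ((1 - t) ^ (s - 1) * t ^ b * (X - t) ^ (-s - b - 1)))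
      (fun t ht => hpt t (by rwa [Set.uIcc_of_le zero_le_one] at ht)),
      intervalIntegral.integral_const_mul] at hsub
    simp only [mul_zero, zero_div, mul_one, div_self hX1.ne'] at hsub
    rw [integral_betaWeight hs hb] at hsub
    rw [← hsub, eulerInt, show -b - 1 = -(b + 1) by ring, rpow_neg hX1.le, rpow_neg hX0.le]
    have := (rpow_pos_of_pos hX1 (b + 1)).ne'
    have := (rpow_pos_of_pos hX0 s).ne'
    field_simp
  · rw [Set.uIcc_of_le zero_le_one]
    exact ContinuousOn.div (by fun_prop) (by fun_prop) fun t ht => (hne t ht).ne'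
  · intro t ht
    simp only [min_eq_left zero_le_one, max_eq_right zero_le_one] at ht
    have h := (hne t (Ioo_subset_Icc_self ht)).ne'
    refine (((hasDerivAt_id t).const_mul (X - 1)).div
      ((hasDerivAt_id t).const_sub X) h).hasDerivWithinAt.congr_deriv ?_
    simp only [id]
    ring
  · rintro _ ⟨t, ht, rfl⟩
    simp only [min_eq_left zero_le_one, max_eq_right zero_le_one] at ht
    have h := hne t (Ioo_subset_Icc_self ht)
    have h1 : 0 < 1 - t := by linarith [ht.2]
    have h2 := ht.1
    refine ContinuousAt.continuousWithinAt (ContinuousAt.mul ?_ ?_)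
    · refine ContinuousAt.rpow_const (by fun_prop) (Or.inl ?_)
      rw [hcompl t (Ioo_subset_Icc_self ht)]
      positivity
    · exact ContinuousAt.rpow_const (by fun_prop) (Or.inl (by positivity))
  · refine IntegrableOn.mono_set ?_ himg
    exact (intervalIntegrable_iff_integrableOn_Icc_of_le zero_le_one).1
      (intervalIntegrable_betaWeight hs hb)
  · rw [Set.uIcc_of_le zero_le_one]
    refine IntegrableOn.congr_fun ?_ (fun t ht => (hpt t ht).symm) measurableSet_Icc
    exact (intervalIntegrable_iff_integrableOn_Icc_of_le zero_le_one).1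
      ((intervalIntegrable_eulerInt hs hb _ hX).const_mul _)

lemma tendsto_eulerInt_one {s b a : ℝ} (hs : 0 < s) (hb : -1 < b) (ha : a ≤ 0)
    (hsa : 0 < s + a) :
    Filter.Tendsto (eulerInt s b a) (nhdsWithin 1 (Ioi 1))
      (nhds (∫ t in (0 : ℝ)..1, (1 - t) ^ (s + a - 1) * t ^ b)) := by
  refine intervalIntegral.tendsto_integral_filter_of_dominated_convergence
    (fun t => (1 - t) ^ (s + a - 1) * t ^ b) ?_ ?_ (intervalIntegrable_betaWeight hsa hb) ?_
  · filter_upwards [self_mem_nhdsWithin] with X hX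
    exact (intervalIntegrable_eulerInt hs hb a hX).aestronglyMeasurable_restrict_uIoc
  · filter_upwards [self_mem_nhdsWithin] with X hX
    filter_upwards [Measure.ae_ne volume 1] with t ht1 ht
    rw [Set.uIoc_of_le zero_le_one] at ht
    have hX' : 1 < X := hX
    have h1 : 0 < 1 - t := by linarith [lt_of_le_of_ne ht.2 ht1]
    have h2 : 0 < X - t := by linarith
    have h3 := ht.1
    rw [norm_of_nonneg (by positivity), show s + a - 1 = (s - 1) + a by ring, rpow_add h1]
    have h4 := rpow_le_rpow_of_nonpos h1 (by linarith : 1 - t ≤ X - t) ha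
    calc _ ≤ (1 - t) ^ (s - 1) * t ^ b * (1 - t) ^ a := by gcongr
      _ = _ := by ring
  · filter_upwards [Measure.ae_ne volume 1] with t ht1 ht
    rw [Set.uIoc_of_le zero_le_one] at ht
    have h1 : 0 < 1 - t := by linarith [lt_of_le_of_ne ht.2 ht1]
    rw [show s + a - 1 = (s - 1) + a by ring, rpow_add h1, mul_right_comm]
    refine Filter.Tendsto.mono_left ?_ nhdsWithin_le_nhds
    refine Filter.Tendsto.const_mul _ ?_
    exact ((continuousAt_id.sub continuousAt_const).rpow_const (Or.inl h1.ne')).tendsto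

lemma tendsto_eulerInt_atTop {s b a : ℝ} (hs : 0 < s) (hb : -1 < b) (ha : a < 0) :
    Filter.Tendsto (eulerInt s b a) Filter.atTop (nhds 0) := by
  rw [← intervalIntegral.integral_zero (E := ℝ) (μ := volume) (a := 0) (b := 1)]
  refine intervalIntegral.tendsto_integral_filter_of_dominated_convergence
    (fun t => (1 - t) ^ (s - 1) * t ^ b) ?_ ?_ (intervalIntegrable_betaWeight hs hb) ?_
  · filter_upwards [Filter.eventually_gt_atTop 1] with X hX
    exact (intervalIntegrable_eulerInt hs hb a hX).aestronglyMeasurable_restrict_uIoc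
  · filter_upwards [Filter.eventually_ge_atTop 2] with X hX
    refine Filter.Eventually.of_forall fun t ht => ?_
    rw [Set.uIoc_of_le zero_le_one] at ht
    have h1 : 0 ≤ 1 - t := by linarith [ht.2]
    have h2 : 1 ≤ X - t := by linarith
    have h3 := ht.1
    have h4 := rpow_le_one_of_one_le_of_nonpos h2 ha.le
    rw [norm_of_nonneg (by positivity)]
    exact mul_le_of_le_one_right (by positivity) h4
  · refine Filter.Eventually.of_forall fun t ht => ?_
    rw [← mul_zero ((1 - t) ^ (s - 1) * t ^ b)]
    refine Filter.Tendsto.const_mul _ ?_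
    have h := tendsto_rpow_neg_atTop (neg_pos.2 ha)
    rw [neg_neg] at h
    exact h.comp (Filter.tendsto_atTop_add_const_right _ (-t) Filter.tendsto_id)

lemma mul_rpow_balanced {z s a b : ℝ} (hz : 0 < z) (h : s + a + b = 0) :
    z * (z ^ (s - 1) * z ^ a * z ^ b) = 1 := by
  rw [← rpow_add hz, ← rpow_add hz, show s - 1 + a + b = -1 by linarith, rpow_neg_one,
    mul_inv_cancel₀ hz.ne']

lemma integral_left_eq_sum_eulerInt {s a b x : ℝ} (hs : 0 < s) (hb : -1 < b)
    (hsum : s + a + b = 0) (hx : x ∈ Ioo (-1 : ℝ) 1) (d : ℕ → ℝ) (N : ℕ) :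
    ∫ y in (-1 : ℝ)..x, (x - y) ^ (s - 1) *
        ((1 - y) ^ a * (1 + y) ^ b * ∑ m ∈ Finset.range N, d m * (1 - y) ^ m) =
      ∑ m ∈ Finset.range N, d m * ((1 + x) ^ m * eulerInt s b (a + m) (2 / (1 + x))) := by
  have h : 0 < 1 + x := by linarith [hx.1]
  have hX : 1 < 2 / (1 + x) := by rw [lt_div_iff₀ h]; linarith [hx.2]
  have hsub := intervalIntegral.smul_integral_comp_mul_add (a := 0) (b := 1)
    (fun y : ℝ => (x - y) ^ (s - 1) *
      ((1 - y) ^ a * (1 + y) ^ b * ∑ m ∈ Finset.range N, d m * (1 - y) ^ m)) (1 + x) (-1)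
  simp only [mul_zero, mul_one, zero_add, smul_eq_mul] at hsub
  rw [show 1 + x + -1 = x by ring] at hsub
  rw [← hsub, ← intervalIntegral.integral_const_mul]
  simp only [eulerInt]
  simp_rw [← intervalIntegral.integral_const_mul]
  rw [← intervalIntegral.integral_finsetSum fun (m : ℕ) _ =>
    ((intervalIntegrable_eulerInt hs hb (a + m) hX).const_mul _).const_mul _]
  refine intervalIntegral.integral_congr_ae (Filter.Eventually.of_forall fun t ht => ?_)
  rw [Set.uIoc_of_le zero_le_one] at ht
  have ht1 : 0 ≤ 1 - t := by linarith [ht.2]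
  have hXt : 0 < 2 / (1 + x) - t := by linarith [ht.2]
  have e1 : x - ((1 + x) * t + -1) = (1 + x) * (1 - t) := by ring
  have e2 : 1 - ((1 + x) * t + -1) = (1 + x) * (2 / (1 + x) - t) := by field_simp; ring
  have e3 : 1 + ((1 + x) * t + -1) = (1 + x) * t := by ring
  rw [e1, e2, e3, mul_rpow h.le ht1, mul_rpow h.le hXt.le, mul_rpow h.le ht.1.le]
  have hpow : (1 + x) * ((1 + x) ^ (s - 1) * (1 + x) ^ a * (1 + x) ^ b) = 1 :=
    mul_rpow_balanced h hsum
  simp_rw [Finset.mul_sum]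
  refine Finset.sum_congr rfl fun m _ => ?_
  rw [mul_pow, rpow_add hXt, rpow_natCast]
  linear_combination ((1 - t) ^ (s - 1) * t ^ b * (2 / (1 + x) - t) ^ a * d m * (1 + x) ^ m *
    (2 / (1 + x) - t) ^ m) * hpow

lemma integral_right_eq_sum_eulerInt {s a b x : ℝ} (hs : 0 < s) (ha : -1 < a)
    (hsum : s + a + b = 0) (hx : x ∈ Ioo (-1 : ℝ) 1) (d : ℕ → ℝ) (N : ℕ) :
    ∫ y in x..(1 : ℝ), (y - x) ^ (s - 1) *
        ((1 - y) ^ a * (1 + y) ^ b * ∑ m ∈ Finset.range N, d m * (1 - y) ^ m) =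
      ∑ m ∈ Finset.range N, d m * ((1 - x) ^ m * eulerInt s (a + m) b (2 / (1 - x))) := by
  have h : 0 < 1 - x := by linarith [hx.2]
  have hX : 1 < 2 / (1 - x) := by rw [lt_div_iff₀ h]; linarith [hx.1]
  have hsub := intervalIntegral.smul_integral_comp_sub_mul (a := 0) (b := 1)
    (fun y : ℝ => (y - x) ^ (s - 1) *
      ((1 - y) ^ a * (1 + y) ^ b * ∑ m ∈ Finset.range N, d m * (1 - y) ^ m)) (1 - x) 1
  simp only [mul_zero, mul_one, sub_zero, smul_eq_mul] at hsub
  rw [show 1 - (1 - x) = x by ring] at hsub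
  rw [← hsub, ← intervalIntegral.integral_const_mul]
  simp only [eulerInt]
  simp_rw [← intervalIntegral.integral_const_mul]
  rw [← intervalIntegral.integral_finsetSum fun (m : ℕ) _ =>
    ((intervalIntegrable_eulerInt hs (by linarith [(m.cast_nonneg : (0 : ℝ) ≤ m)] : -1 < a + m) b
      hX).const_mul _).const_mul _]
  refine intervalIntegral.integral_congr_ae (Filter.Eventually.of_forall fun t ht => ?_)
  rw [Set.uIoc_of_le zero_le_one] at ht
  have ht1 : 0 ≤ 1 - t := by linarith [ht.2]
  have hXt : 0 < 2 / (1 - x) - t := by linarith [ht.2]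
  have e1 : 1 - (1 - x) * t - x = (1 - x) * (1 - t) := by ring
  have e2 : 1 + (1 - (1 - x) * t) = (1 - x) * (2 / (1 - x) - t) := by field_simp; ring
  have e3 : 1 - (1 - (1 - x) * t) = (1 - x) * t := by ring
  rw [e1, e2, e3, mul_rpow h.le ht1, mul_rpow h.le hXt.le, mul_rpow h.le ht.1.le]
  have hpow : (1 - x) * ((1 - x) ^ (s - 1) * (1 - x) ^ a * (1 - x) ^ b) = 1 :=
    mul_rpow_balanced h hsum
  simp_rw [Finset.mul_sum]
  refine Finset.sum_congr rfl fun m _ => ?_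
  rw [mul_pow, rpow_add ht.1, rpow_natCast]
  linear_combination ((1 - t) ^ (s - 1) * t ^ a * (2 / (1 - x) - t) ^ b * d m * (1 - x) ^ m *
    t ^ m) * hpow

/-- The reflection formula `sin(πν) Γ(1+ν) Γ(1-ν) = πν`, including `ν = 0`. -/
lemma sin_mul_Gamma_mul_Gamma {v : ℝ} (h1 : -1 < v) (h2 : v ≤ 0) :
    Real.sin (π * v) * (Real.Gamma (v + 1) * Real.Gamma (1 - v)) = π * v := by
  rcases h2.eq_or_lt with rfl | h2
  · simp
  have h := Real.Gamma_mul_Gamma_one_sub (-v)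
  rw [sub_neg_eq_add, mul_neg, Real.sin_neg] at h
  have hs : Real.sin (π * v) ≠ 0 := by
    refine (Real.sin_neg_of_neg_of_neg_pi_lt ?_ ?_).ne <;> nlinarith [pi_pos]
  rw [show 1 - v = -v + 1 by ring, Real.Gamma_add_one (neg_ne_zero.2 h2.ne), add_comm v]
  rw [eq_div_iff (neg_ne_zero.2 hs)] at h
  linear_combination v * h

lemma sin_mul_eulerInt_sub_one_symm {s μ ν x : ℝ} (hs : 0 < s) (hμ1 : -1 < μ) (hμ2 : μ ≤ 0)
    (hν1 : -1 < ν) (hν2 : ν ≤ 0) (hsum : s + μ + ν = 0) (hx : x ∈ Ioo (-1 : ℝ) 1) :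
    Real.sin (π * ν) * μ * eulerInt s ν (μ - 1) (2 / (1 + x)) * (1 - x) ^ 2 =
      Real.sin (π * μ) * ν * eulerInt s μ (ν - 1) (2 / (1 - x)) * (1 + x) ^ 2 := by
  have hp : 0 < 1 + x := by linarith [hx.1]
  have hm : 0 < 1 - x := by linarith [hx.2]
  have hXp : 1 < 2 / (1 + x) := by rw [lt_div_iff₀ hp]; linarith
  have hXm : 1 < 2 / (1 - x) := by rw [lt_div_iff₀ hm]; linarith
  rw [show μ - 1 = -s - ν - 1 by linarith, show ν - 1 = -s - μ - 1 by linarith,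
    eulerInt_closed_form hs hν1 hXp, eulerInt_closed_form hs hμ1 hXm,
    show 2 / (1 + x) - 1 = (1 - x) / (1 + x) by field_simp; ring,
    show 2 / (1 - x) - 1 = (1 + x) / (1 - x) by field_simp; ring,
    div_rpow hm.le hp.le, div_rpow hp.le hm.le, div_rpow zero_le_two hp.le,
    div_rpow zero_le_two hm.le, show ν + 1 + s = 1 - μ by linarith,
    show μ + 1 + s = 1 - ν by linarith]
  have pw : ∀ z : ℝ, 0 < z → z ^ (-ν - 1) * z ^ (-μ - 1) * z ^ (-s) * z ^ 2 = 1 := by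
    intro z hz
    rw [← rpow_natCast, ← rpow_add hz, ← rpow_add hz, ← rpow_add hz]
    push_cast
    rw [show -ν - 1 + (-μ - 1) + -s + 2 = 0 by linarith, rpow_zero]
  have g1 := sin_mul_Gamma_mul_Gamma hμ1 hμ2
  have g2 := sin_mul_Gamma_mul_Gamma hν1 hν2
  have n1 := (Real.Gamma_pos_of_pos (by linarith : 0 < 1 - μ)).ne'
  have n2 := (Real.Gamma_pos_of_pos (by linarith : 0 < 1 - ν)).ne'
  have hconst : Real.sin (π * ν) * μ * (Real.Gamma (ν + 1) * Real.Gamma s / Real.Gamma (1 - μ)) =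
      Real.sin (π * μ) * ν * (Real.Gamma (μ + 1) * Real.Gamma s / Real.Gamma (1 - ν)) := by
    rw [mul_div_assoc', mul_div_assoc', div_eq_div_iff n1 n2]
    linear_combination Real.Gamma s * (μ * g2 - ν * g1)
  have hpow : (1 - x) ^ (-ν - 1) / (1 + x) ^ (-ν - 1) * (2 ^ (-s) / (1 + x) ^ (-s)) * (1 - x) ^ 2 =
      (1 + x) ^ (-μ - 1) / (1 - x) ^ (-μ - 1) * (2 ^ (-s) / (1 - x) ^ (-s)) * (1 + x) ^ 2 := by
    have hA := pw _ hm
    have hB := pw _ hp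
    have p1 := (rpow_pos_of_pos hm (-μ - 1)).ne'
    have p2 := (rpow_pos_of_pos hm (-s)).ne'
    have p3 := (rpow_pos_of_pos hp (-ν - 1)).ne'
    have p4 := (rpow_pos_of_pos hp (-s)).ne'
    rw [div_mul_div_comm, div_mul_div_comm, div_mul_eq_mul_div, div_mul_eq_mul_div,
      div_eq_div_iff (mul_ne_zero p3 p4) (mul_ne_zero p1 p2)]
    linear_combination 2 ^ (-s) * (hA - hB)
  linear_combination ((1 - x) ^ (-ν - 1) / (1 + x) ^ (-ν - 1) * (2 ^ (-s) / (1 + x) ^ (-s)) *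
    (1 - x) ^ 2) * hconst + (Real.sin (π * μ) * ν *
    (Real.Gamma (μ + 1) * Real.Gamma s / Real.Gamma (1 - ν))) * hpow

/-- The two Euler integrals at conjugate arguments combine to a constant. -/
lemma sin_mul_eulerInt_add {s μ ν x : ℝ} (hs0 : 0 < s) (hs1 : s < 1) (hμ2 : μ ≤ 0)
    (hν2 : ν ≤ 0) (hsum : s + μ + ν = 0) (hx : x ∈ Ioo (-1 : ℝ) 1) :
    Real.sin (π * ν) * eulerInt s ν μ (2 / (1 + x)) +
      Real.sin (π * μ) * eulerInt s μ ν (2 / (1 - x)) = -π := by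
  have hμ1 : -1 < μ := by linarith
  have hν1 : -1 < ν := by linarith
  rcases hν2.eq_or_lt with rfl | hν2'
  · obtain rfl : μ = -s := by linarith
    have hG := Real.Gamma_mul_Gamma_one_sub s
    have hne : Real.sin (π * s) ≠ 0 := by
      refine (Real.sin_pos_of_pos_of_lt_pi ?_ ?_).ne' <;> nlinarith [pi_pos]
    have : eulerInt s (-s) 0 (2 / (1 - x)) = π / Real.sin (π * s) := by
      simp only [eulerInt, rpow_zero, mul_one]
      rw [integral_betaWeight hs0 hμ1, ← hG]
      simp [show -s + 1 = 1 - s by ring, mul_comm]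
    rw [this, mul_neg, Real.sin_neg]
    simp
    field_simp
  set W : ℝ → ℝ := fun x => Real.sin (π * ν) * eulerInt s ν μ (2 / (1 + x)) +
      Real.sin (π * μ) * eulerInt s μ ν (2 / (1 - x)) with hW
  have hder : ∀ z ∈ Ioo (-1 : ℝ) 1, HasDerivAt W 0 z := by
    intro z hz
    have hp : 0 < 1 + z := by linarith [hz.1]
    have hm : 0 < 1 - z := by linarith [hz.2]
    have hXp : 1 < 2 / (1 + z) := by rw [lt_div_iff₀ hp]; linarith
    have hXm : 1 < 2 / (1 - z) := by rw [lt_div_iff₀ hm]; linarith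
    have d1 : HasDerivAt (fun z : ℝ => 2 / (1 + z)) (-2 / (1 + z) ^ 2) z := by
      refine ((hasDerivAt_const z (2 : ℝ)).div ((hasDerivAt_id z).const_add 1)
        hp.ne').congr_deriv ?_
      simp
    have d2 : HasDerivAt (fun z : ℝ => 2 / (1 - z)) (2 / (1 - z) ^ 2) z := by
      refine ((hasDerivAt_const z (2 : ℝ)).div ((hasDerivAt_id z).const_sub 1)
        hm.ne').congr_deriv ?_
      simp
    have e1 := ((hasDerivAt_eulerInt hs0 hν1 μ hXp).comp z d1).const_mul (Real.sin (π * ν))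
    have e2 := ((hasDerivAt_eulerInt hs0 hμ1 ν hXm).comp z d2).const_mul (Real.sin (π * μ))
    refine (e1.add e2).congr_deriv ?_
    have key := sin_mul_eulerInt_sub_one_symm hs0 hμ1 hμ2 hν1 hν2 hsum hz
    field_simp
    linear_combination -2 * key
  have hconst : ∀ z ∈ Ioo (-1 : ℝ) 1, W z = W x := fun z hz =>
    isOpen_Ioo.is_const_of_deriv_eq_zero isPreconnected_Ioo
      (fun y hy => (hder y hy).differentiableAt.differentiableWithinAt)
      (fun y hy => (hder y hy).deriv) hz hx
  have hlim : Filter.Tendsto W (nhdsWithin 1 (Iio 1)) (nhds (-π)) := by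
    have l1 : Filter.Tendsto (fun z : ℝ => 2 / (1 + z)) (nhdsWithin 1 (Iio 1))
        (nhdsWithin 1 (Ioi 1)) := by
      refine tendsto_nhdsWithin_iff.2 ⟨?_, ?_⟩
      · refine Filter.Tendsto.mono_left ?_ nhdsWithin_le_nhds
        have : ContinuousAt (fun z : ℝ => 2 / (1 + z)) 1 := by
          refine ContinuousAt.div (by fun_prop) (by fun_prop) (by norm_num)
        convert this.tendsto using 2
        norm_num
      · filter_upwards [Ioo_mem_nhdsLT (show (-1 : ℝ) < 1 by norm_num)] with z hz
        rw [Set.mem_Ioi, lt_div_iff₀ (by linarith [hz.1])]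
        linarith [hz.2]
    have l2 : Filter.Tendsto (fun z : ℝ => 2 / (1 - z)) (nhdsWithin 1 (Iio 1))
        Filter.atTop := by
      have h0 : Filter.Tendsto (fun z : ℝ => 1 - z) (nhdsWithin 1 (Iio 1))
          (nhdsWithin 0 (Ioi 0)) := by
        refine tendsto_nhdsWithin_iff.2 ⟨?_, ?_⟩
        · refine Filter.Tendsto.mono_left ?_ nhdsWithin_le_nhds
          have : ContinuousAt (fun z : ℝ => 1 - z) 1 := by fun_prop
          convert this.tendsto using 2
          norm_num
        · filter_upwards [self_mem_nhdsWithin] with z hz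
          exact sub_pos.2 (Set.mem_Iio.1 hz)
      exact (tendsto_inv_nhdsGT_zero.comp h0).const_mul_atTop zero_lt_two
    have t1 := ((tendsto_eulerInt_one hs0 hν1 hμ2 (by linarith)).comp l1).const_mul
      (Real.sin (π * ν))
    have t2 := ((tendsto_eulerInt_atTop hs0 hμ1 hν2').comp l2).const_mul (Real.sin (π * μ))
    have hval : Real.sin (π * ν) * (∫ t in (0 : ℝ)..1, (1 - t) ^ (s + μ - 1) * t ^ ν) +
        Real.sin (π * μ) * 0 = -π := by
      rw [integral_betaWeight (by linarith) hν1, show s + μ = -ν by linarith,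
        show ν + 1 + -ν = 1 by ring, Real.Gamma_one]
      have h := sin_mul_Gamma_mul_Gamma hν1 hν2
      rw [show 1 - ν = -ν + 1 by ring, Real.Gamma_add_one (neg_ne_zero.2 hν2'.ne)] at h
      refine mul_left_cancel₀ hν2'.ne ?_
      linear_combination -h
    rw [← hval]
    exact t1.add t2
  refine tendsto_nhds_unique (tendsto_const_nhds.congr' ?_) hlim
  filter_upwards [Ioo_mem_nhdsLT (show (-1 : ℝ) < 1 by norm_num)] with z hz
  exact (hconst z hz).symm

/-- Coefficients of the binomial series `(1 - c t)^(-e)`. -/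
def binomSeq (c e : ℝ) (i : ℕ) : ℝ := c ^ i * ∏ l ∈ Finset.range i, ((l : ℝ) + e) / (l + 1)

lemma binomSeq_zero (c e : ℝ) : binomSeq c e 0 = 1 := by simp [binomSeq]

lemma binomSeq_succ (c e : ℝ) (i : ℕ) :
    ((i : ℝ) + 1) * binomSeq c e (i + 1) = c * (i + e) * binomSeq c e i := by
  have : (i : ℝ) + 1 ≠ 0 := by positivity
  rw [binomSeq, binomSeq, Finset.prod_range_succ, pow_succ]
  field_simp

lemma one_sub_mul_derivative_binomSeq (c e : ℝ) :
    (1 - PowerSeries.C c * PowerSeries.X) *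
        PowerSeries.derivative ℝ (PowerSeries.mk (binomSeq c e)) =
      PowerSeries.C (c * e) * PowerSeries.mk (binomSeq c e) := by
  ext i
  rw [sub_mul, one_mul, mul_assoc, map_sub, PowerSeries.coeff_C_mul, PowerSeries.coeff_C_mul,
    PowerSeries.coeff_derivative]
  cases i with
  | zero =>
    have := binomSeq_succ c e 0
    simp at this ⊢
    linarith
  | succ i =>
    rw [PowerSeries.coeff_succ_X_mul, PowerSeries.coeff_derivative]
    simp only [PowerSeries.coeff_mk]
    have := binomSeq_succ c e (i + 1)
    push_cast at this ⊢
    linear_combination this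

/-- Convolution of two binomial coefficient sequences. -/
def binomConv (c e c' e' : ℝ) (m : ℕ) : ℝ :=
  PowerSeries.coeff m (PowerSeries.mk (binomSeq c e) * PowerSeries.mk (binomSeq c' e'))

lemma binomConv_eq_sum (c e c' e' : ℝ) (m : ℕ) :
    binomConv c e c' e' m =
      ∑ k ∈ Finset.range (m + 1), binomSeq c e (m - k) * binomSeq c' e' k := by
  rw [binomConv, mul_comm, PowerSeries.coeff_mul,
    Finset.Nat.sum_antidiagonal_eq_sum_range_succ_mk]
  simp only [PowerSeries.coeff_mk]
  exact Finset.sum_congr rfl fun k _ => mul_comm _ _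

lemma binomConv_three_term (c e c' e' : ℝ) (m : ℕ) :
    ((m : ℝ) + 2) * binomConv c e c' e' (m + 2) =
      (c * (m + 1 + e) + c' * (m + 1 + e')) * binomConv c e c' e' (m + 1)
        - c * c' * (m + e + e') * binomConv c e c' e' m := by
  have h1 := one_sub_mul_derivative_binomSeq c e
  have h2 := one_sub_mul_derivative_binomSeq c' e'
  set f := PowerSeries.mk (binomSeq c e) with hf
  set g := PowerSeries.mk (binomSeq c' e') with hg
  have h : PowerSeries.derivative ℝ (f * g)
      - PowerSeries.C (c + c') * (PowerSeries.X * PowerSeries.derivative ℝ (f * g))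
      + PowerSeries.C (c * c') *
        (PowerSeries.X * (PowerSeries.X * PowerSeries.derivative ℝ (f * g))) =
      PowerSeries.C (c * e + c' * e') * (f * g)
      - PowerSeries.C (c * c' * (e + e')) * (PowerSeries.X * (f * g)) := by
    rw [Derivation.leibniz]
    simp only [smul_eq_mul, map_add, map_mul] at h1 h2 ⊢
    linear_combination g * (1 - PowerSeries.C c' * PowerSeries.X) * h1
      + f * (1 - PowerSeries.C c * PowerSeries.X) * h2
  have hX : PowerSeries.coeff m (PowerSeries.X * PowerSeries.derivative ℝ (f * g)) =
      m * PowerSeries.coeff m (f * g) := by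
    cases m with
    | zero => simp
    | succ m =>
      rw [PowerSeries.coeff_succ_X_mul, PowerSeries.coeff_derivative]
      push_cast
      ring
  have hc := congrArg (PowerSeries.coeff (m + 1)) h
  simp only [map_add, map_sub, PowerSeries.coeff_succ_X_mul, PowerSeries.coeff_C_mul, hX,
    PowerSeries.coeff_derivative] at hc
  simp only [← map_add, PowerSeries.coeff_C_mul, PowerSeries.coeff_succ_X_mul,
    PowerSeries.coeff_derivative] at hc
  unfold binomConv
  push_cast at hc
  linear_combination hc

/-- The weighted combination of left and right Euler integrals which computes the two-sided
fractional integral of the Jacobi weight times `(1 - y)^m`. -/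
def twoSidedMoment (s μ ν x : ℝ) (m : ℕ) : ℝ :=
  Real.sin (π * ν) * ((1 + x) ^ m * eulerInt s ν (μ + m) (2 / (1 + x))) +
    Real.sin (π * μ) * ((1 - x) ^ m * eulerInt s (μ + m) ν (2 / (1 - x)))

lemma twoSidedMoment_three_term {s μ ν x : ℝ} (hs : 0 < s) (hμ1 : -1 < μ)
    (hν1 : -1 < ν) (hsum : s + μ + ν = 0) (hx : x ∈ Ioo (-1 : ℝ) 1) (m : ℕ) :
    ((m : ℝ) + 2) * twoSidedMoment s μ ν x (m + 2) =
      (2 * (m + 1 + -ν) + (1 - x) * (m + 1 + (1 - s))) * twoSidedMoment s μ ν x (m + 1)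
        - 2 * (1 - x) * (m + -ν + (1 - s)) * twoSidedMoment s μ ν x m := by
  have hp : 0 < 1 + x := by linarith [hx.1]
  have hm : 0 < 1 - x := by linarith [hx.2]
  have hXp : 1 < 2 / (1 + x) := by rw [lt_div_iff₀ hp]; linarith
  have hXm : 1 < 2 / (1 - x) := by rw [lt_div_iff₀ hm]; linarith
  have hb : -1 < μ + m := by linarith [(m.cast_nonneg : (0 : ℝ) ≤ m)]
  have l := eulerInt_three_term (a := μ + m) hs hν1 hXp
  have r := eulerInt_three_term (a := ν) hs hb hXm
  have r1 := eulerInt_add_one (a := ν) hs hb hXm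
  have r2 := eulerInt_add_one (a := ν + 1) hs hb hXm
  have r3 := eulerInt_add_one (a := ν) hs (show -1 < μ + m + 1 by linarith) hXm
  rw [show ν + 1 + 1 = ν + 2 by ring] at r2
  rw [show μ + m + 1 + 1 = μ + m + 2 by ring] at r3
  rw [r2, r1, r3] at r
  have hp2 : 2 / (1 + x) * (1 + x) = 2 := div_mul_cancel₀ _ hp.ne'
  have hm2 : 2 / (1 - x) * (1 - x) = 2 := div_mul_cancel₀ _ hm.ne'
  obtain rfl : s = -μ - ν := by linarith
  unfold twoSidedMoment
  push_cast
  rw [← add_assoc, ← add_assoc]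
  generalize 2 / (1 + x) = X at *
  generalize 2 / (1 - x) = Y at *
  generalize eulerInt (-μ - ν) ν (μ + m) X = L0 at *
  generalize eulerInt (-μ - ν) ν (μ + m + 1) X = L1 at *
  generalize eulerInt (-μ - ν) ν (μ + m + 2) X = L2 at *
  generalize eulerInt (-μ - ν) (μ + m) ν Y = R0 at *
  generalize eulerInt (-μ - ν) (μ + m + 1) ν Y = R1 at *
  generalize eulerInt (-μ - ν) (μ + m + 2) ν Y = R2 at *
  have l' : (1 + x) ^ 2 * ((m + 2) * L2) = (2 * (m + 1 + -ν) + (1 - x) * (m + 1 + (1 - (-μ - ν)))) *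
      ((1 + x) * L1) - 2 * (1 - x) * (m + -ν + (1 - (-μ - ν))) * L0 := by
    linear_combination (1 + x) ^ 2 * l + ((-μ + 1 + 2 * (μ + m + 1)) * (1 + x) * L1
      - (μ + m + 1) * (X * (1 + x) + 2 - (1 + x)) * L0) * hp2
  have r' : (1 - x) ^ 2 * ((m + 2) * R2) = (2 * (m + 1 + -ν) + (1 - x) * (m + 1 + (1 - (-μ - ν)))) *
      ((1 - x) * R1) - 2 * (1 - x) * (m + -ν + (1 - (-μ - ν))) * R0 := by
    linear_combination (1 - x) ^ 2 * r + (-(μ + m + 1) * (1 - x) * R0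
      + (-ν + m + 1) * (1 - x) * R1) * hm2
  rw [pow_add, pow_add, pow_succ, pow_succ]
  linear_combination Real.sin (π * ν) * (1 + x) ^ m * l' + Real.sin (π * μ) * (1 - x) ^ m * r'

lemma twoSidedMoment_zero {s μ ν x : ℝ} (hs0 : 0 < s) (hs1 : s < 1) (hμ2 : μ ≤ 0)
    (hν2 : ν ≤ 0) (hsum : s + μ + ν = 0) (hx : x ∈ Ioo (-1 : ℝ) 1) :
    twoSidedMoment s μ ν x 0 = -π := by
  simpa [twoSidedMoment] using sin_mul_eulerInt_add hs0 hs1 hμ2 hν2 hsum hx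

lemma twoSidedMoment_one {s μ ν x : ℝ} (hs0 : 0 < s) (hs1 : s < 1) (hμ2 : μ ≤ 0)
    (hν2 : ν ≤ 0) (hsum : s + μ + ν = 0) (hx : x ∈ Ioo (-1 : ℝ) 1) :
    twoSidedMoment s μ ν x 1 = -π * (-2 * ν + (1 - s) * (1 - x)) := by
  have hμ1 : -1 < μ := by linarith
  have hν1 : -1 < ν := by linarith
  have hp : 0 < 1 + x := by linarith [hx.1]
  have hm : 0 < 1 - x := by linarith [hx.2]
  have hXp : 1 < 2 / (1 + x) := by rw [lt_div_iff₀ hp]; linarith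
  have hXm : 1 < 2 / (1 - x) := by rw [lt_div_iff₀ hm]; linarith
  have l := eulerInt_three_term (a := μ - 1) hs0 hν1 hXp
  have r := eulerInt_three_term (a := ν - 1) hs0 hμ1 hXm
  have r1 := eulerInt_add_one (a := ν) hs0 hμ1 hXm
  have hsymm := sin_mul_eulerInt_sub_one_symm hs0 hμ1 hμ2 hν1 hν2 hsum hx
  have hadd := sin_mul_eulerInt_add hs0 hs1 hμ2 hν2 hsum hx
  rw [show μ - 1 + 2 = μ + 1 by ring, show μ - 1 + 1 = μ by ring] at l
  rw [show ν - 1 + 2 = ν + 1 by ring, show ν - 1 + 1 = ν by ring, r1] at r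
  obtain rfl : s = -μ - ν := by linarith
  unfold twoSidedMoment
  rw [Nat.cast_one, pow_one, pow_one]
  generalize eulerInt (-μ - ν) ν (μ - 1) (2 / (1 + x)) = L0 at *
  generalize eulerInt (-μ - ν) ν μ (2 / (1 + x)) = L1 at *
  generalize eulerInt (-μ - ν) ν (μ + 1) (2 / (1 + x)) = L2 at *
  generalize eulerInt (-μ - ν) μ (ν - 1) (2 / (1 - x)) = R0 at *
  generalize eulerInt (-μ - ν) μ ν (2 / (1 - x)) = R1 at *
  generalize eulerInt (-μ - ν) (μ + 1) ν (2 / (1 - x)) = R2 at *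
  generalize Real.sin (π * ν) = S at *
  generalize Real.sin (π * μ) = T at *
  have l' : L2 * (1 + x) ^ 2 = (-2 * ν + (1 - (-μ - ν)) * (1 - x)) * (1 + x) * L1
      - 2 * (1 - x) * μ * L0 := by
    field_simp at l
    linear_combination l
  have r' : R2 * (1 - x) ^ 2 = (-2 * ν + (1 - (-μ - ν)) * (1 - x)) * (1 - x) * R1
      + 2 * (1 + x) * ν * R0 := by
    field_simp at r
    linear_combination -r
  have hne : (1 + x) * (1 - x) ≠ 0 := by positivity
  refine mul_left_cancel₀ hne ?_
  linear_combination S * (1 - x) * l' + T * (1 + x) * r' - 2 * hsymm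
    + (-2 * ν + (1 - (-μ - ν)) * (1 - x)) * (1 + x) * (1 - x) * hadd

lemma twoSidedMoment_eq {s μ ν x : ℝ} (hs0 : 0 < s) (hs1 : s < 1) (hμ2 : μ ≤ 0)
    (hν2 : ν ≤ 0) (hsum : s + μ + ν = 0) (hx : x ∈ Ioo (-1 : ℝ) 1) (m : ℕ) :
    twoSidedMoment s μ ν x m = -π * binomConv 2 (-ν) (1 - x) (1 - s) m := by
  induction m using Nat.twoStepInduction with
  | zero =>
    rw [twoSidedMoment_zero hs0 hs1 hμ2 hν2 hsum hx, binomConv_eq_sum]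
    simp [binomSeq_zero]
  | one =>
    rw [twoSidedMoment_one hs0 hs1 hμ2 hν2 hsum hx, binomConv_eq_sum]
    simp [Finset.sum_range_succ, binomSeq]
    ring
  | more m h0 h1 =>
    have hm : (m : ℝ) + 2 ≠ 0 := by positivity
    have ht := twoSidedMoment_three_term hs0 (by linarith) (by linarith) hsum hx m
    rw [h0, h1] at ht
    refine mul_left_cancel₀ hm ?_
    linear_combination ht + π * binomConv_three_term 2 (-ν) (1 - x) (1 - s) m

/-- Coefficients of the Jacobi polynomial `P_n^{a,b}` in powers of `1 - x`. -/
def jacobiCoeff (n : ℕ) (a b : ℝ) (m : ℕ) : ℝ :=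
  (Real.Gamma (a + n + 1) * Real.Gamma (a + b + n + m + 1)) /
    ((m.factorial : ℝ) * ((n - m).factorial : ℝ) * Real.Gamma (a + b + n + 1) *
      Real.Gamma (a + m + 1)) * (-1 / 2) ^ m

lemma jacobiP_eq_sum_jacobiCoeff (n : ℕ) (a b x : ℝ) :
    jacobiP n a b x = ∑ m ∈ Finset.range (n + 1), jacobiCoeff n a b m * (1 - x) ^ m := by
  refine Finset.sum_congr rfl fun m _ => ?_
  rw [jacobiCoeff, mul_assoc _ (_ ^ m) (_ ^ m), ← mul_pow]
  congr 2
  ring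

lemma jacobiCoeff_succ {n m : ℕ} {a b : ℝ} (ha : -1 < a) (hab : -1 < a + b) (hm : m < n) :
    2 * ((m : ℝ) + 1) * (m + 1 + a) * jacobiCoeff n a b (m + 1) =
      -((n - m) * (n + m + 1 + a + b)) * jacobiCoeff n a b m := by
  obtain ⟨k, rfl⟩ := Nat.exists_eq_add_of_lt hm
  have hm0 : (0 : ℝ) ≤ m := m.cast_nonneg
  have hk0 : (0 : ℝ) ≤ k := k.cast_nonneg
  have e1 : m + k + 1 - (m + 1) = k := by omega
  have e2 : m + k + 1 - m = k + 1 := by omega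
  have g1 := Real.Gamma_add_one (s := a + m + 1) (by linarith)
  have g2 := Real.Gamma_add_one (s := a + b + (m + k + 1) + m + 1) (by linarith)
  have p1 : Real.Gamma (a + m + 1) ≠ 0 := (Real.Gamma_pos_of_pos (by linarith)).ne'
  have p2 : Real.Gamma (a + b + (m + k + 1) + 1) ≠ 0 :=
    (Real.Gamma_pos_of_pos (by linarith)).ne'
  have f1 : (m.factorial : ℝ) ≠ 0 := by positivity
  have f2 : (k.factorial : ℝ) ≠ 0 := by positivity
  have hma : a + m + 1 ≠ 0 := by linarith
  have hm1 : (m : ℝ) + 1 ≠ 0 := by positivity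
  have hk1 : (k : ℝ) + 1 ≠ 0 := by positivity
  unfold jacobiCoeff
  rw [e1, e2, Nat.factorial_succ, Nat.factorial_succ]
  push_cast
  rw [show a + ((m : ℝ) + 1) + 1 = a + m + 1 + 1 by ring, g1,
    show a + b + ((m : ℝ) + k + 1) + (m + 1) + 1 = a + b + (m + k + 1) + m + 1 + 1 by ring, g2,
    pow_succ]
  field_simp
  ring

lemma jacobiCoeff_top_comm {n : ℕ} {a b : ℝ} (ha : -1 < a) (hb : -1 < b) :
    jacobiCoeff n a b n = jacobiCoeff n b a n := by
  have hn : (0 : ℝ) ≤ n := n.cast_nonneg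
  have p1 : Real.Gamma (a + n + 1) ≠ 0 := (Real.Gamma_pos_of_pos (by linarith)).ne'
  have p2 : Real.Gamma (b + n + 1) ≠ 0 := (Real.Gamma_pos_of_pos (by linarith)).ne'
  unfold jacobiCoeff
  rw [add_comm b a]
  field_simp

/-- The coefficients obtained by collecting powers of `1 - x` after applying the two-sided
fractional integral to a weighted Jacobi polynomial. -/
def jacobiTail (n : ℕ) (μ ν : ℝ) (k : ℕ) : ℝ :=
  ∑ j ∈ Finset.range (n - k + 1), jacobiCoeff n μ ν (k + j) * binomSeq 2 (-ν) j

lemma jacobiTail_partial {n k : ℕ} {μ ν : ℝ} (hμ : -1 < μ) (hμν : -1 < μ + ν) (J : ℕ)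
    (hJ : k + J ≤ n) :
    (k * (k + 1 + μ + ν) - n * (n + 1 + μ + ν)) *
        ∑ j ∈ Finset.range (J + 1), jacobiCoeff n μ ν (k + j) * binomSeq 2 (-ν) j
      - 2 * (k + 1 + μ + ν) * (k + 1 + ν) *
        ∑ j ∈ Finset.range J, jacobiCoeff n μ ν (k + 1 + j) * binomSeq 2 (-ν) j =
      ((k + J) * (k + J + 1 + μ + ν) - n * (n + 1 + μ + ν)) *
        (jacobiCoeff n μ ν (k + J) * binomSeq 2 (-ν) J) := by
  induction J with
  | zero => simp
  | succ J ih =>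
    have hc := jacobiCoeff_succ hμ hμν (show k + J < n by omega)
    have hA := binomSeq_succ 2 (-ν) J
    have ih := ih (by omega)
    rw [Finset.sum_range_succ _ (J + 1), Finset.sum_range_succ (fun j =>
      jacobiCoeff n μ ν (k + 1 + j) * binomSeq 2 (-ν) j) J, ← add_assoc k J 1,
      show k + 1 + J = k + J + 1 by ring]
    push_cast at hc ⊢
    linear_combination ih - binomSeq 2 (-ν) J * hc
      - jacobiCoeff n μ ν (k + J + 1) * (2 * k + J + 2 + μ + ν) * hA

lemma jacobiTail_succ {n k : ℕ} {μ ν : ℝ} (hμ : -1 < μ) (hμν : -1 < μ + ν) (hk : k < n) :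
    (k * (k + 1 + μ + ν) - n * (n + 1 + μ + ν)) * jacobiTail n μ ν k =
      2 * (k + 1 + μ + ν) * (k + 1 + ν) * jacobiTail n μ ν (k + 1) := by
  obtain ⟨i, rfl⟩ := Nat.exists_eq_add_of_lt hk
  have h := jacobiTail_partial (n := k + i + 1) (k := k) hμ hμν (i + 1) (by omega)
  unfold jacobiTail
  rw [show k + i + 1 - k = i + 1 by omega, show k + i + 1 - (k + 1) = i by omega]
  push_cast at h ⊢
  linear_combination h

lemma Gamma_mul_binomSeq {e : ℝ} (he : 0 < e) (n : ℕ) :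
    Real.Gamma e * binomSeq 1 e n = Real.Gamma (n + e) / n.factorial := by
  induction n with
  | zero => simp [binomSeq_zero]
  | succ n ih =>
    have hn : (n : ℝ) + 1 ≠ 0 := by positivity
    have hf : (n.factorial : ℝ) ≠ 0 := by positivity
    have hA := binomSeq_succ 1 e n
    have hg := Real.Gamma_add_one (s := n + e) (by positivity)
    push_cast [Nat.factorial_succ]
    rw [show (n : ℝ) + 1 + e = n + e + 1 by ring, hg]
    refine mul_left_cancel₀ hn ?_
    rw [eq_div_iff hf] at ih
    field_simp
    linear_combination Real.Gamma e * n.factorial * hA + (n + e) * ih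

lemma Gamma_mul_binomSeq_mul_jacobiTail {n k : ℕ} {μ ν : ℝ} (hμ : -1 < μ) (hν : -1 < ν)
    (hμν : -1 < μ + ν) (hk : k ≤ n) :
    Real.Gamma (1 + μ + ν) * binomSeq 1 (1 + μ + ν) k * jacobiTail n μ ν k =
      Real.Gamma (n + (1 + μ + ν)) / n.factorial * jacobiCoeff n ν μ k := by
  induction hk using Nat.decreasingInduction with
  | self =>
    rw [Gamma_mul_binomSeq (by linarith), jacobiCoeff_top_comm hν hμ]
    simp [jacobiTail, binomSeq_zero]
  | of_succ k hk ih =>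
    have hkn : (k : ℝ) < n := by exact_mod_cast hk
    have hk0 : (0 : ℝ) ≤ k := k.cast_nonneg
    have hne : (k : ℝ) * (k + 1 + μ + ν) - n * (n + 1 + μ + ν) ≠ 0 := by
      have : (n - k : ℝ) * (n + k + 1 + μ + ν) ≠ 0 :=
        mul_ne_zero (by linarith) (by linarith)
      intro h
      exact this (by linear_combination -h)
    have hT := jacobiTail_succ hμ hμν hk
    have hA := binomSeq_succ 1 (1 + μ + ν) k
    have hc := jacobiCoeff_succ (n := n) (m := k) (a := ν) (b := μ) hν (by linarith) hk
    refine mul_left_cancel₀ hne ?_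
    linear_combination Real.Gamma (1 + μ + ν) * binomSeq 1 (1 + μ + ν) k * hT
      - 2 * (k + 1 + ν) * Real.Gamma (1 + μ + ν) * jacobiTail n μ ν (k + 1) * hA
      + 2 * (k + 1) * (k + 1 + ν) * ih
      + Real.Gamma (n + (1 + μ + ν)) / n.factorial * hc

lemma sum_jacobiCoeff_mul_binomConv (n : ℕ) (μ ν e z : ℝ) :
    ∑ m ∈ Finset.range (n + 1), jacobiCoeff n μ ν m * binomConv 2 (-ν) z e m =
      ∑ k ∈ Finset.range (n + 1), binomSeq 1 e k * jacobiTail n μ ν k * z ^ k := by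
  simp only [binomConv_eq_sum, Finset.mul_sum]
  rw [Finset.sum_comm' (t' := Finset.range (n + 1)) (s' := fun k => Finset.Ico k (n + 1))
    (fun m k => by simp only [Finset.mem_range, Finset.mem_Ico]; omega)]
  refine Finset.sum_congr rfl fun k hk => ?_
  rw [Finset.mem_range] at hk
  rw [Finset.sum_Ico_eq_sum_range, jacobiTail, Finset.mul_sum, Finset.sum_mul,
    show n + 1 - k = n - k + 1 by omega]
  refine Finset.sum_congr rfl fun j _ => ?_
  rw [Nat.add_sub_cancel_left, binomSeq, binomSeq, binomSeq]
  ring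

lemma Gamma_mul_sum_binomConv_eq_jacobiP {μ ν : ℝ} (hμ : -1 < μ) (hν : -1 < ν)
    (hμν : -1 < μ + ν) (n : ℕ) (x : ℝ) :
    Real.Gamma (1 + μ + ν) * ∑ m ∈ Finset.range (n + 1),
        jacobiCoeff n μ ν m * binomConv 2 (-ν) (1 - x) (1 + μ + ν) m =
      Real.Gamma (n + (1 + μ + ν)) / n.factorial * jacobiP n ν μ x := by
  rw [sum_jacobiCoeff_mul_binomConv, jacobiP_eq_sum_jacobiCoeff, Finset.mul_sum, Finset.mul_sum]
  refine Finset.sum_congr rfl fun k hk => ?_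
  have := Gamma_mul_binomSeq_mul_jacobiTail (n := n) (k := k) hμ hν hμν
    (Nat.lt_succ_iff.mp (Finset.mem_range.mp hk))
  linear_combination (1 - x) ^ k * this

theorem statement2 (α p μ ν : ℝ)
    (hα1 : 1 < α) (hα2 : α < 2) (hp0 : 0 ≤ p) (hp1 : p ≤ 1)
    (hμ1 : α - 2 ≤ μ) (hμ2 : μ ≤ 0) (hν1 : α - 2 ≤ ν) (hν2 : ν ≤ 0)
    (hsum : μ + ν = α - 2)
    (hbal : p * Real.sin (π * μ) = (1 - p) * Real.sin (π * ν))
    (n : ℕ) (x : ℝ) (hx : x ∈ Set.Ioo (-1 : ℝ) 1) :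
    Ip α μ ν p (2 - α) (Jpf n μ ν) x =
      (Real.Gamma (n + α - 1) / Real.Gamma (n + 1)) * jacobiP n ν μ x := by
  obtain ⟨s, rfl⟩ : ∃ s, α = 2 - s := ⟨2 - α, by ring⟩
  have hs0 : 0 < s := by linarith
  have hs1 : s < 1 := by linarith
  have hs : s + μ + ν = 0 := by linarith
  have hsinpos : 0 < Real.sin (π * s) :=
    Real.sin_pos_of_pos_of_lt_pi (by positivity) (by nlinarith [Real.pi_pos])
  have hsin : Real.sin (π * (2 - s)) = -Real.sin (π * s) := by
    rw [show π * (2 - s) = 2 * π - π * s by ring, Real.sin_two_pi_sub]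
  have hG := Real.Gamma_mul_Gamma_one_sub s
  have hGs : Real.Gamma s ≠ 0 := (Real.Gamma_pos_of_pos hs0).ne'
  have hmom : Real.sin (π * ν) * ∑ m ∈ Finset.range (n + 1), jacobiCoeff n μ ν m *
        ((1 + x) ^ m * eulerInt s ν (μ + m) (2 / (1 + x))) +
      Real.sin (π * μ) * ∑ m ∈ Finset.range (n + 1), jacobiCoeff n μ ν m *
        ((1 - x) ^ m * eulerInt s (μ + m) ν (2 / (1 - x))) =
      -π * ∑ m ∈ Finset.range (n + 1),
        jacobiCoeff n μ ν m * binomConv 2 (-ν) (1 - x) (1 - s) m := by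
    rw [Finset.mul_sum, Finset.mul_sum, Finset.mul_sum, ← Finset.sum_add_distrib]
    refine Finset.sum_congr rfl fun m _ => ?_
    have h := twoSidedMoment_eq hs0 hs1 hμ2 hν2 hs hx m
    unfold twoSidedMoment at h
    linear_combination jacobiCoeff n μ ν m * h
  have hP := Gamma_mul_sum_binomConv_eq_jacobiP (μ := μ) (ν := ν) (by linarith) (by linarith)
    (by linarith) n x
  rw [show 1 + μ + ν = 1 - s by linarith] at hP
  unfold Ip Il Ir Cap Jpf
  simp only [sub_sub_cancel, if_neg hs0.ne', jacobiP_eq_sum_jacobiCoeff n μ ν]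
  rw [integral_left_eq_sum_eulerInt hs0 (by linarith) hs hx,
    integral_right_eq_sum_eulerInt hs0 (by linarith) hs hx, Real.Gamma_nat_eq_factorial,
    show (n : ℝ) + (2 - s) - 1 = n + (1 - s) by ring, ← hP, hsin]
  rw [eq_div_iff hsinpos.ne'] at hG
  generalize ∑ m ∈ Finset.range (n + 1), jacobiCoeff n μ ν m *
    ((1 + x) ^ m * eulerInt s ν (μ + m) (2 / (1 + x))) = A at *
  generalize ∑ m ∈ Finset.range (n + 1), jacobiCoeff n μ ν m *
    ((1 - x) ^ m * eulerInt s (μ + m) ν (2 / (1 - x))) = B at *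
  generalize ∑ m ∈ Finset.range (n + 1),
    jacobiCoeff n μ ν m * binomConv 2 (-ν) (1 - x) (1 - s) m = Q at *
  field_simp
  linear_combination (B - A) * hbal - hmom - Q * hG
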